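/- Every bounded linear operator T : L¹(μ) → L¹(μ) is regular: there exist bounded positive linear operators T₁, T₂ : L¹(μ) → L¹(μ) such that T = T₁ − T₂. -/

import Mathlib

open MeasureTheory Filter Topology
open scoped ENNReal NNReal

section helper
variable {X : Type*} [MeasurableSpace X] {μ : Measure X}

lemma aux_norm_add (a b : Lp ℝ 1 μ) (ha : 0 ≤ a) (hb : 0 ≤ b) : ‖a + b‖ = ‖a‖ + ‖b‖ := by
  rw [L1.norm_eq_integral_norm, L1.norm_eq_integral_norm, L1.norm_eq_integral_norm,
    ← integral_add (L1.integrable_coeFn a).norm (L1.integrable_coeFn b).norm]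
  apply integral_congr_ae
  rw [← Lp.coeFn_nonneg] at ha hb
  filter_upwards [Lp.coeFn_add a b, ha, hb] with x h h1 h2
  simp only [Pi.zero_apply] at h1 h2
  rw [h, Pi.add_apply, Real.norm_of_nonneg h1, Real.norm_of_nonneg h2,
    Real.norm_of_nonneg (add_nonneg h1 h2)]

lemma aux_sup (D : Set (Lp ℝ 1 μ)) (hne : D.Nonempty) (hd : DirectedOn (· ≤ ·) D)
    (h0 : ∀ x ∈ D, 0 ≤ x) (C : ℝ) (hC : ∀ x ∈ D, ‖x‖ ≤ C) :
    ∃ s, IsLUB D s ∧ ‖s‖ ≤ C := by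
  have : Nonempty D := hne.to_subtype
  have : IsDirectedOrder D := ⟨fun a b => by
    obtain ⟨c, hc, h1, h2⟩ := hd a a.2 b b.2
    exact ⟨⟨c, hc⟩, h1, h2⟩⟩
  have hbdd : BddAbove (Set.range fun d : D => ‖(d : Lp ℝ 1 μ)‖) :=
    ⟨C, by rintro _ ⟨d, rfl⟩; exact hC d d.2⟩
  have hcau : Cauchy (map (fun d : D => (d : Lp ℝ 1 μ)) atTop) := by
    rw [Metric.cauchy_iff]
    refine ⟨inferInstance, fun ε hε => ?_⟩
    obtain ⟨d, hdd⟩ := exists_lt_of_lt_ciSup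
      (show (⨆ d : D, ‖(d : Lp ℝ 1 μ)‖) - ε / 2 < ⨆ d : D, ‖(d : Lp ℝ 1 μ)‖ by linarith)
    have key : ∀ e : D, d ≤ e → ‖(e : Lp ℝ 1 μ) - d‖ < ε / 2 := by
      intro e he
      have h1 := aux_norm_add (e - d : Lp ℝ 1 μ) d (sub_nonneg.2 he) (h0 d d.2)
      rw [sub_add_cancel] at h1
      have h2 := le_ciSup hbdd e
      linarith
    refine ⟨_, image_mem_map (Ici_mem_atTop d), ?_⟩
    rintro _ ⟨x, hx, rfl⟩ _ ⟨y, hy, rfl⟩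
    have h1 := key x hx
    have h2 := key y hy
    rw [← dist_eq_norm] at h1 h2
    have := dist_triangle_right (x : Lp ℝ 1 μ) y d
    linarith
  obtain ⟨s, hs⟩ := CompleteSpace.complete hcau
  have hs' : Tendsto (fun d : D => (d : Lp ℝ 1 μ)) atTop (𝓝 s) := hs
  refine ⟨s, ?_, ?_⟩
  · have hm : Monotone (fun d : D => (d : Lp ℝ 1 μ)) := fun a b h => h
    have := isLUB_of_tendsto_atTop hm hs'
    simpa using this
  · exact le_of_tendsto hs'.norm (Eventually.of_forall fun d => hC d d.2)

variable (T : Lp ℝ 1 μ →L[ℝ] Lp ℝ 1 μ)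

noncomputable def auxV (l : List (Lp ℝ 1 μ)) : Lp ℝ 1 μ := (l.map fun x => |T x|).sum

lemma auxV_append (l m : List (Lp ℝ 1 μ)) : auxV T (l ++ m) = auxV T l + auxV T m := by
  simp [auxV]

lemma auxV_cons (x) (m : List (Lp ℝ 1 μ)) : auxV T (x :: m) = |T x| + auxV T m := by
  simp [auxV]

lemma auxV_nonneg (l : List (Lp ℝ 1 μ)) : 0 ≤ auxV T l := by
  induction l with
  | nil => simp [auxV]
  | cons x l ih => rw [auxV_cons]; exact add_nonneg (abs_nonneg _) ih

lemma auxV_ge (l : List (Lp ℝ 1 μ)) : |T l.sum| ≤ auxV T l := by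
  induction l with
  | nil => simp [auxV]
  | cons x l ih =>
    rw [auxV_cons, List.sum_cons, map_add]
    exact (abs_add_le _ _).trans (add_le_add le_rfl ih)

lemma auxV_norm (l : List (Lp ℝ 1 μ)) (hl : ∀ x ∈ l, 0 ≤ x) : ‖auxV T l‖ ≤ ‖T‖ * ‖l.sum‖ := by
  induction l with
  | nil => simp [auxV]
  | cons x l ih =>
    have h := ih fun y hy => hl y (List.mem_cons_of_mem _ hy)
    rw [auxV_cons, List.sum_cons, aux_norm_add x _ (hl x List.mem_cons_self)
      (List.sum_nonneg fun y hy => hl y (List.mem_cons_of_mem _ hy)), mul_add]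
    refine (norm_add_le _ _).trans (add_le_add ?_ h)
    rw [norm_abs_eq_norm]
    exact T.le_opNorm x

lemma auxV_split (l : List (Lp ℝ 1 μ)) : ∀ (a b : Lp ℝ 1 μ), (∀ x ∈ l, 0 ≤ x) → 0 ≤ a → 0 ≤ b →
    l.sum = a + b → ∃ l₁ l₂ : List (Lp ℝ 1 μ), (∀ x ∈ l₁, 0 ≤ x) ∧ (∀ x ∈ l₂, 0 ≤ x) ∧
      l₁.sum = a ∧ l₂.sum = b ∧ auxV T l ≤ auxV T l₁ + auxV T l₂ := by
  induction l with
  | nil =>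
    intro a b _ ha hb h
    simp only [List.sum_nil] at h
    have := (add_eq_zero_iff_of_nonneg ha hb).1 h.symm
    exact ⟨[], [], by simp, by simp, by simp [this.1], by simp [this.2], by simp [auxV]⟩
  | cons x l ih =>
    intro a b hl ha hb h
    have hx := hl x List.mem_cons_self
    have hl' : ∀ y ∈ l, 0 ≤ y := fun y hy => hl y (List.mem_cons_of_mem _ hy)
    have hs : 0 ≤ l.sum := List.sum_nonneg hl'
    rw [List.sum_cons] at h
    have hxab : x ≤ a + b := by rw [← h]; exact le_add_of_nonneg_right hs
    have h2 : x - x ⊓ a ≤ b := by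
      rw [sub_le_comm]
      exact le_inf (sub_le_self _ hb) (sub_le_iff_le_add.2 hxab)
    obtain ⟨l₁, l₂, p1, p2, s1, s2, hv⟩ := ih (a - x ⊓ a) (b - (x - x ⊓ a)) hl'
      (sub_nonneg.2 inf_le_right) (sub_nonneg.2 h2) (by
        rw [← eq_sub_iff_add_eq'] at h; rw [h]; abel)
    refine ⟨x ⊓ a :: l₁, (x - x ⊓ a) :: l₂, ?_, ?_, ?_, ?_, ?_⟩
    · simp only [List.mem_cons, forall_eq_or_imp]
      exact ⟨le_inf hx ha, p1⟩
    · simp only [List.mem_cons, forall_eq_or_imp]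
      exact ⟨sub_nonneg.2 inf_le_left, p2⟩
    · rw [List.sum_cons, s1]; abel
    · rw [List.sum_cons, s2]; abel
    · rw [auxV_cons, auxV_cons, auxV_cons]
      have h3 : |T x| ≤ |T (x ⊓ a)| + |T (x - x ⊓ a)| := by
        have := abs_add_le (T (x ⊓ a)) (T (x - x ⊓ a))
        rwa [← map_add, add_sub_cancel] at this
      calc |T x| + auxV T l ≤ (|T (x ⊓ a)| + |T (x - x ⊓ a)|) + (auxV T l₁ + auxV T l₂) :=
            add_le_add h3 hv
        _ = _ := by abel

lemma auxV_dir (l : List (Lp ℝ 1 μ)) : ∀ (m : List (Lp ℝ 1 μ)), (∀ x ∈ l, 0 ≤ x) →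
    (∀ x ∈ m, 0 ≤ x) → m.sum = l.sum → ∃ k : List (Lp ℝ 1 μ), (∀ x ∈ k, 0 ≤ x) ∧
      k.sum = l.sum ∧ auxV T l ≤ auxV T k ∧ auxV T m ≤ auxV T k := by
  induction l with
  | nil =>
    intro m _ hm h
    exact ⟨m, hm, h, by simpa [auxV] using auxV_nonneg T m, le_rfl⟩
  | cons x l ih =>
    intro m hl hm h
    have hx := hl x List.mem_cons_self
    have hl' : ∀ y ∈ l, 0 ≤ y := fun y hy => hl y (List.mem_cons_of_mem _ hy)
    rw [List.sum_cons] at h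
    obtain ⟨l₁, l₂, p1, p2, s1, s2, hv⟩ := auxV_split T m x l.sum hm hx (List.sum_nonneg hl') h
    obtain ⟨k, pk, sk, v1, v2⟩ := ih l₂ hl' p2 s2
    refine ⟨l₁ ++ k, ?_, ?_, ?_, ?_⟩
    · intro y hy
      rcases List.mem_append.1 hy with hy | hy
      exacts [p1 y hy, pk y hy]
    · rw [List.sum_append, List.sum_cons, s1, sk]
    · rw [auxV_append, auxV_cons]
      refine add_le_add ?_ v1
      have := auxV_ge T l₁
      rwa [s1] at this
    · rw [auxV_append]
      exact hv.trans (add_le_add le_rfl v2)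

noncomputable def auxA (f : Lp ℝ 1 μ) : Set (Lp ℝ 1 μ) :=
  {s | ∃ l : List (Lp ℝ 1 μ), (∀ x ∈ l, 0 ≤ x) ∧ l.sum = f ∧ auxV T l = s}

lemma auxA_sup (f : Lp ℝ 1 μ) (hf : 0 ≤ f) : ∃ s, IsLUB (auxA T f) s ∧ ‖s‖ ≤ ‖T‖ * ‖f‖ := by
  apply aux_sup
  · exact ⟨_, [f], by simpa using hf, by simp, rfl⟩
  · rintro _ ⟨l, hl, sl, rfl⟩ _ ⟨m, hm, sm, rfl⟩
    obtain ⟨k, hk, sk, h1, h2⟩ := auxV_dir T l m hl hm (sm.trans sl.symm)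
    exact ⟨_, ⟨k, hk, sk.trans sl, rfl⟩, h1, h2⟩
  · rintro _ ⟨l, hl, sl, rfl⟩
    exact auxV_nonneg T l
  · rintro _ ⟨l, hl, sl, rfl⟩
    rw [← sl]
    exact auxV_norm T l hl

lemma aux_main : ∃ L : Lp ℝ 1 μ → Lp ℝ 1 μ, (∀ f, 0 ≤ f → ‖L f‖ ≤ ‖T‖ * ‖f‖) ∧
    (∀ f, 0 ≤ f → |T f| ≤ L f) ∧ ∀ f g, 0 ≤ f → 0 ≤ g → L (f + g) = L f + L g := by
  choose! L hL hn using auxA_sup T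
  refine ⟨L, hn, fun f hf => (hL f hf).1 ⟨[f], by simpa using hf, by simp, by simp [auxV]⟩,
    fun f g hf hg => le_antisymm ?_ ?_⟩
  · apply (hL _ (add_nonneg hf hg)).2
    rintro _ ⟨l, hl, sl, rfl⟩
    obtain ⟨l₁, l₂, p1, p2, s1, s2, hv⟩ := auxV_split T l f g hl hf hg sl
    exact hv.trans (add_le_add ((hL f hf).1 ⟨l₁, p1, s1, rfl⟩) ((hL g hg).1 ⟨l₂, p2, s2, rfl⟩))
  · rw [← le_sub_iff_add_le]
    apply (hL f hf).2
    rintro _ ⟨l, hl, sl, rfl⟩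
    rw [le_sub_comm]
    apply (hL g hg).2
    rintro _ ⟨m, hm, sm, rfl⟩
    rw [le_sub_iff_add_le', ← auxV_append]
    refine (hL _ (add_nonneg hf hg)).1 ⟨l ++ m, ?_, by simp [sl, sm], rfl⟩
    intro y hy
    rcases List.mem_append.1 hy with hy | hy
    exacts [hl y hy, hm y hy]

lemma aux_final : ∃ P : Lp ℝ 1 μ →L[ℝ] Lp ℝ 1 μ, ∀ f, 0 ≤ f → |T f| ≤ P f := by
  obtain ⟨L, hn, hT, hadd⟩ := aux_main T
  have key : ∀ a b c d : Lp ℝ 1 μ, 0 ≤ a → 0 ≤ b → 0 ≤ c → 0 ≤ d → a - b = c - d →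
      L a - L b = L c - L d := by
    intro a b c d ha hb hc hd h
    rw [sub_eq_sub_iff_add_eq_add] at h ⊢
    rw [← hadd a d ha hd, ← hadd c b hc hb, h]
  let P : Lp ℝ 1 μ →+ Lp ℝ 1 μ := AddMonoidHom.mk' (fun f => L f⁺ - L f⁻) (by
    intro f g
    have h := key (f + g)⁺ (f + g)⁻ (f⁺ + g⁺) (f⁻ + g⁻) (posPart_nonneg _) (negPart_nonneg _)
      (add_nonneg (posPart_nonneg _) (posPart_nonneg _))
      (add_nonneg (negPart_nonneg _) (negPart_nonneg _)) (by
        rw [posPart_sub_negPart, add_sub_add_comm, posPart_sub_negPart, posPart_sub_negPart])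
    rw [h, hadd _ _ (posPart_nonneg _) (posPart_nonneg _),
      hadd _ _ (negPart_nonneg _) (negPart_nonneg _)]
    abel)
  have hP : ∀ f, P f = L f⁺ - L f⁻ := fun f => rfl
  have hc : Continuous P := by
    apply AddMonoidHomClass.continuous_of_bound P ‖T‖
    intro f
    rw [hP]
    refine (norm_sub_le _ _).trans ((add_le_add (hn _ (posPart_nonneg _))
      (hn _ (negPart_nonneg _))).trans ?_)
    rw [← mul_add, ← aux_norm_add _ _ (posPart_nonneg _) (negPart_nonneg _),
      posPart_add_negPart, norm_abs_eq_norm]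
  refine ⟨P.toRealLinearMap hc, fun f hf => ?_⟩
  have h0 : L 0 = 0 := by simpa using hadd 0 0 le_rfl le_rfl
  have : P.toRealLinearMap hc f = L f := by
    change L f⁺ - L f⁻ = L f
    rw [posPart_of_nonneg hf, negPart_of_nonneg hf, h0, sub_zero]
  rw [this]
  exact hT f hf

end helper

theorem stmt_3 {X : Type*} [MeasurableSpace X] (μ : Measure X) [SigmaFinite μ]
    (T : Lp ℝ 1 μ →L[ℝ] Lp ℝ 1 μ) :
    ∃ T₁ T₂ : Lp ℝ 1 μ →L[ℝ] Lp ℝ 1 μ,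
      (∀ x : Lp ℝ 1 μ, 0 ≤ x → 0 ≤ T₁ x) ∧
      (∀ x : Lp ℝ 1 μ, 0 ≤ x → 0 ≤ T₂ x) ∧
      T = T₁ - T₂ := by
  obtain ⟨P, hP⟩ := aux_final T
  refine ⟨P, P - T, fun x hx => (abs_nonneg _).trans (hP x hx), fun x hx => ?_, by abel⟩
  exact sub_nonneg.2 ((le_abs_self _).trans (hP x hx))
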